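/- arXiv:1709.06052 — 4 statements merged into one kernel-verified Lean document; each statement's English description precedes it below -/
import Mathlib

section
/- Let t⁺, t⁻ ∈ (−1, 1) \ {0} and set Y := 4 t⁺ t⁻ / ((1 + (t⁺)²)(1 + (t⁻)²)). Then for every r ∈ ℝ, the identity (t⁺ t⁻ − r)(1 − t⁺ t⁻ r) = −(t⁺ − t⁻ r)(t⁻ − t⁺ r) holds if and only if r² − (2/Y) r + 1 = 0. -/
/-- **Algebraic core of the quasi-planar solvability theorem.**
For `t⁺, t⁻ ∈ (−1,1) \ {0}` and `Y := 4 t⁺ t⁻ / ((1 + (t⁺)²)(1 + (t⁻)²))`, the identity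
`(t⁺t⁻ − r)(1 − t⁺t⁻ r) = −(t⁺ − t⁻ r)(t⁻ − t⁺ r)` holds for `r ∈ ℝ` if and only if
`r² − (2/Y) r + 1 = 0`. -/
theorem stmt_11 (tp tm : ℝ)
    (htp1 : -1 < tp) (htp2 : tp < 1) (htp0 : tp ≠ 0)
    (htm1 : -1 < tm) (htm2 : tm < 1) (htm0 : tm ≠ 0)
    (Y : ℝ) (hY : Y = 4 * tp * tm / ((1 + tp ^ 2) * (1 + tm ^ 2))) :
    ∀ r : ℝ,
      (tp * tm - r) * (1 - tp * tm * r) = -((tp - tm * r) * (tm - tp * r)) ↔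
        r ^ 2 - (2 / Y) * r + 1 = 0 := by
  intro r
  have hcoef : 2 / Y = (1 + tp ^ 2) * (1 + tm ^ 2) / (2 * (tp * tm)) := by
    rw [hY]
    field_simp
    norm_num
  have hne : 2 * (tp * tm) ≠ 0 := mul_ne_zero two_ne_zero (mul_ne_zero htp0 htm0)
  have hfactor : (tp * tm - r) * (1 - tp * tm * r) - -((tp - tm * r) * (tm - tp * r)) =
      2 * (tp * tm) * (r ^ 2 - (2 / Y) * r + 1) := by
    rw [hcoef]
    field_simp
    ring
  rw [← sub_eq_zero, hfactor, mul_eq_zero, or_iff_right hne]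
end

section
/- For every W ∈ ℂ and every (k₁, k₂) ∈ ℝ², det(I₄ − W·T·D_k) = (1 + W²)² − 2W(1 − W²)(cos k₁ + cos k₂), where T and D_k are the explicit 4 × 4 matrices defined in the context. -/
open Complex

/-- The Fourier block of the periodic Kac–Ward matrix of the square lattice:
the matrix `T` acting on the four edge directions. -/
noncomputable def KWBlockT : Matrix (Fin 4) (Fin 4) ℂ :=
  !![1, 0, Complex.exp (-(Real.pi / 4 : ℝ) * I), Complex.exp ((Real.pi / 4 : ℝ) * I);
     0, 1, Complex.exp ((Real.pi / 4 : ℝ) * I), Complex.exp (-(Real.pi / 4 : ℝ) * I);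
     Complex.exp ((Real.pi / 4 : ℝ) * I), Complex.exp (-(Real.pi / 4 : ℝ) * I), 1, 0;
     Complex.exp (-(Real.pi / 4 : ℝ) * I), Complex.exp ((Real.pi / 4 : ℝ) * I), 0, 1]

/-- The diagonal momentum matrix `D_k = diag(e^{−ik₁}, e^{ik₁}, e^{ik₂}, e^{−ik₂})`. -/
noncomputable def KWBlockD (k₁ k₂ : ℝ) : Matrix (Fin 4) (Fin 4) ℂ :=
  Matrix.diagonal
    ![Complex.exp (-(k₁ : ℂ) * I), Complex.exp ((k₁ : ℂ) * I),
      Complex.exp ((k₂ : ℂ) * I), Complex.exp (-(k₂ : ℂ) * I)]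

/-- The Kac–Ward determinant with the phases as indeterminates: the turning phases `p`, `q` satisfy
`p * q = 1` and `p ^ 2 + q ^ 2 = 0`, and the momentum phases are mutually inverse in pairs. -/
theorem det_one_sub_smul_kacWardBlock {R : Type*} [CommRing R] {p q a b c d : R} (W : R)
    (hpq : p * q = 1) (hsq : p ^ 2 + q ^ 2 = 0) (hab : a * b = 1) (hcd : c * d = 1) :
    Matrix.det ((1 : Matrix (Fin 4) (Fin 4) R) - W •
      (!![1, 0, p, q; 0, 1, q, p; q, p, 1, 0; p, q, 0, 1] * Matrix.diagonal ![a, b, c, d])) =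
      (1 + W ^ 2) ^ 2 - W * (1 - W ^ 2) * ((a + b) + (c + d)) := by
  simp [Matrix.det_succ_row_zero, Fin.sum_univ_succ, Fin.succAbove, Matrix.one_apply,
    Matrix.vecMul_diagonal]
  grind

/-- **Determinant of the Fourier block of the periodic Kac–Ward matrix.**
For every `W ∈ ℂ` and `(k₁,k₂) ∈ ℝ²`,
`det(I₄ − W·T·D_k) = (1 + W²)² − 2W(1 − W²)(cos k₁ + cos k₂)`. -/
theorem stmt_13 (W : ℂ) (k₁ k₂ : ℝ) :
    Matrix.det ((1 : Matrix (Fin 4) (Fin 4) ℂ) - W • (KWBlockT * KWBlockD k₁ k₂)) =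
      (1 + W ^ 2) ^ 2 -
        2 * W * (1 - W ^ 2) * ((Real.cos k₁ : ℂ) + (Real.cos k₂ : ℂ)) := by
  have hpq : exp (-(Real.pi / 4 : ℝ) * I) * exp ((Real.pi / 4 : ℝ) * I) = 1 := by
    rw [← exp_add, neg_mul, neg_add_cancel, exp_zero]
  have hsq : exp (-(Real.pi / 4 : ℝ) * I) ^ 2 + exp ((Real.pi / 4 : ℝ) * I) ^ 2 = 0 := by
    have h := two_cos (Real.pi / 2 : ℂ)
    rw [cos_pi_div_two, mul_zero] at h
    rw [← exp_nat_mul, ← exp_nat_mul, add_comm, h]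
    push_cast
    congr 2 <;> ring
  have hab : exp (-(k₁ : ℂ) * I) * exp ((k₁ : ℂ) * I) = 1 := by
    rw [← exp_add, neg_mul, neg_add_cancel, exp_zero]
  have hcd : exp ((k₂ : ℂ) * I) * exp (-(k₂ : ℂ) * I) = 1 := by
    rw [← exp_add, neg_mul, add_neg_cancel, exp_zero]
  rw [KWBlockT, KWBlockD, det_one_sub_smul_kacWardBlock W hpq hsq hab hcd, ofReal_cos, ofReal_cos]
  linear_combination W * (1 - W ^ 2) * (two_cos (k₁ : ℂ) + two_cos (k₂ : ℂ))
end

section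
/- Fix L ≥ 3 and let K^per be the periodic Kac–Ward matrix of the L × L torus. Then for every W ∈ ℂ, det(1 − W·K^per) = ∏_{m ∈ {0, …, L−1}²} [ (1 + W²)² − 2W(1 − W²)(cos(2π m₁/L) + cos(2π m₂/L)) ]. -/
/-- A direction, viewed as a complex number. -/
noncomputable def dirC (d : ℤ × ℤ) : ℂ := (d.1 : ℂ) + (d.2 : ℂ) * Complex.I

/-- The Kac–Ward phase `exp(i ∠(d,d')/2)`, where `∠(d,d') ∈ (−π, π]` is the rotation
angle from `d` to `d'` (realised as the argument of `d'·conj(d)`). -/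
noncomputable def KWphase (d d' : ℤ × ℤ) : ℂ :=
  Complex.exp (Complex.I * (Complex.arg (dirC d' * (starRingEnd ℂ) (dirC d)) : ℂ) / 2)

/-- The four nearest-neighbour directions of the square lattice. -/
def dirVec : Fin 4 → ℤ × ℤ := ![(1, 0), (-1, 0), (0, 1), (0, -1)]

/-- The step of a direction on the torus `(ℤ/Lℤ)²`. -/
def torusStep (L : ℕ) (i : Fin 4) : ZMod L × ZMod L :=
  (((dirVec i).1 : ZMod L), ((dirVec i).2 : ZMod L))

/-- The periodic Kac–Ward matrix of the `L × L` torus, indexed by the darts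
`(x, d)` with `x ∈ (ℤ/Lℤ)²` and `d` one of the four directions:
`K^per_{(x,d),(x',d')} = exp(i∠(d,d')/2)` if `x' = x + d` and `d' ≠ −d`, else `0`. -/
noncomputable def KperM (L : ℕ) :
    Matrix ((ZMod L × ZMod L) × Fin 4) ((ZMod L × ZMod L) × Fin 4) ℂ := fun e e' =>
  if e'.1 = e.1 + torusStep L e.2 ∧ dirVec e'.2 ≠ -dirVec e.2
    then KWphase (dirVec e.2) (dirVec e'.2) else 0

/-- The character table of `(ℤ/Lℤ)²`: rows are positions, columns are Fourier modes. -/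
noncomputable def torusFourier (L : ℕ) [NeZero L] :
    Matrix (ZMod L × ZMod L) (ZMod L × ZMod L) ℂ := fun x m =>
  ZMod.stdAddChar (m.1 * x.1 + m.2 * x.2)

/-- The four-by-four matrix of Kac–Ward phases between non-opposite directions. -/
noncomputable def phaseMatrix : Matrix (Fin 4) (Fin 4) ℂ := fun i j =>
  if dirVec j ≠ -dirVec i then KWphase (dirVec i) (dirVec j) else 0

/-- The block of the periodic Kac–Ward matrix at the Fourier mode `m`. -/
noncomputable def modeBlock (L : ℕ) [NeZero L] (m : ZMod L × ZMod L) :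
    Matrix (Fin 4) (Fin 4) ℂ := fun i j =>
  torusFourier L (torusStep L i) m * phaseMatrix i j

theorem torusFourier_add (L : ℕ) [NeZero L] (x y m : ZMod L × ZMod L) :
    torusFourier L (x + y) m = torusFourier L x m * torusFourier L y m := by
  simp only [torusFourier, Prod.fst_add, Prod.snd_add, ← AddChar.map_add_eq_mul]
  congr 1
  ring

theorem det_torusFourier_ne_zero (L : ℕ) [NeZero L] : (torusFourier L).det ≠ 0 := by
  have orthogonality : torusFourier L * Matrix.of (fun m y => torusFourier L (-y) m) =
      ((L : ℂ) * L) • 1 := by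
    ext x y
    have h (a : ZMod L) := AddChar.sum_mulShift a (ZMod.isPrimitive_stdAddChar L)
    simp only [Matrix.mul_apply, Matrix.of_apply, ← torusFourier_add]
    simp only [torusFourier, AddChar.map_add_eq_mul, Fintype.sum_prod_type,
      ← Finset.mul_sum, ← Finset.sum_mul, h, Matrix.smul_apply, Matrix.one_apply]
    simp only [Prod.fst_add, Prod.snd_add, Prod.fst_neg, Prod.snd_neg, add_neg_eq_zero,
      Prod.ext_iff, ZMod.card]
    split_ifs <;> simp_all
  intro h
  have hdet := congrArg Matrix.det orthogonality
  rw [Matrix.det_mul, h, zero_mul, Matrix.det_smul, Matrix.det_one, mul_one] at hdet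
  have hL : (L : ℂ) ≠ 0 := Nat.cast_ne_zero.mpr (NeZero.ne L)
  exact pow_ne_zero _ (mul_ne_zero hL hL) hdet.symm

open Matrix Kronecker in
theorem KperM_mul_fourier (L : ℕ) [NeZero L] :
    KperM L * (torusFourier L ⊗ₖ (1 : Matrix (Fin 4) (Fin 4) ℂ)) =
      (torusFourier L ⊗ₖ (1 : Matrix (Fin 4) (Fin 4) ℂ)) *
        (blockDiagonal (modeBlock L)).submatrix Prod.swap Prod.swap := by
  ext ⟨x, i⟩ ⟨m, j⟩
  trans torusFourier L (x + torusStep L i) m * phaseMatrix i j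
  · simp [mul_apply, Fintype.sum_prod_type, KperM, phaseMatrix, one_apply, ite_and, mul_comm]
  · simp [mul_apply, Fintype.sum_prod_type, modeBlock, one_apply, blockDiagonal_apply,
      torusFourier_add, mul_assoc]

open Matrix Kronecker in
theorem det_one_sub_smul_KperM (L : ℕ) [NeZero L] (W : ℂ) :
    (1 - W • KperM L).det = ∏ m, (1 - W • modeBlock L m).det := by
  have intertwining : (1 - W • KperM L) * (torusFourier L ⊗ₖ (1 : Matrix (Fin 4) (Fin 4) ℂ)) =
      (torusFourier L ⊗ₖ (1 : Matrix (Fin 4) (Fin 4) ℂ)) *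
        (blockDiagonal fun m => 1 - W • modeBlock L m).submatrix
          (Equiv.prodComm _ _) (Equiv.prodComm _ _) := by
    have hblock : (blockDiagonal fun m => 1 - W • modeBlock L m) =
        1 - W • blockDiagonal (modeBlock L) := by
      rw [← blockDiagonal_one, ← blockDiagonal_smul, ← blockDiagonal_sub]
      rfl
    rw [hblock, submatrix_sub, submatrix_smul, Pi.sub_apply, Pi.sub_apply, Pi.smul_apply,
      Pi.smul_apply, submatrix_one_equiv, Matrix.sub_mul, Matrix.mul_sub, one_mul, mul_one,
      smul_mul_assoc, mul_smul_comm, KperM_mul_fourier]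
    rfl
  have hF : (torusFourier L ⊗ₖ (1 : Matrix (Fin 4) (Fin 4) ℂ)).det ≠ 0 := by
    simpa [det_kronecker] using det_torusFourier_ne_zero L
  have hdet := congrArg det intertwining
  rw [det_mul, det_mul, det_submatrix_equiv_self, det_blockDiagonal, mul_comm] at hdet
  exact mul_left_cancel₀ hF hdet

theorem phaseMatrix_eq : phaseMatrix =
    let p := Complex.exp (Complex.I * (Real.pi / 2 : ℝ) / 2)
    let q := Complex.exp (Complex.I * (-(Real.pi / 2) : ℝ) / 2)
    !![1, 0, p, q; 0, 1, q, p; q, p, 1, 0; p, q, 0, 1] := by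
  ext i j
  fin_cases i <;> fin_cases j <;>
    simp [phaseMatrix, dirVec, KWphase, dirC, Complex.arg_I, Complex.arg_neg_I]

theorem det_four_direction_block {R : Type*} [CommRing R] (W z w u v p q : R)
    (hzw : z * w = 1) (huv : u * v = 1) (hpq : p * q = 1) (hsq : p ^ 2 + q ^ 2 = 0) :
    (1 - W • Matrix.of fun i j => ![z, w, u, v] i *
      !![1, 0, p, q; 0, 1, q, p; q, p, 1, 0; p, q, 0, 1] i j).det =
      (1 + W ^ 2) ^ 2 - W * (1 - W ^ 2) * (z + w + u + v) := by
  have hentries : (1 - W • Matrix.of fun i j => ![z, w, u, v] i *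
      !![1, 0, p, q; 0, 1, q, p; q, p, 1, 0; p, q, 0, 1] i j) =
      !![1 - W * z, 0, -(W * z * p), -(W * z * q);
        0, 1 - W * w, -(W * w * q), -(W * w * p);
        -(W * u * q), -(W * u * p), 1 - W * u, 0;
        -(W * v * p), -(W * v * q), 0, 1 - W * v] := by
    ext i j
    fin_cases i <;> fin_cases j <;> simp [mul_assoc]
  rw [hentries]
  simp only [Matrix.det_succ_row_zero (n := 3), Fin.sum_univ_four, Matrix.det_fin_three]
  simp [Fin.succAbove]
  grind

theorem stdAddChar_add_stdAddChar_neg (L : ℕ) [NeZero L] (a : ZMod L) :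
    ZMod.stdAddChar a + ZMod.stdAddChar (-a) =
      2 * (Real.cos (2 * Real.pi * (a.val : ℝ) / (L : ℝ)) : ℂ) := by
  have ha : a = ((a.val : ℤ) : ZMod L) := by simp
  conv_lhs => rw [ha, ← Int.cast_neg, ZMod.stdAddChar_coe, ZMod.stdAddChar_coe]
  rw [Complex.ofReal_cos, Complex.two_cos]
  push_cast
  congr 2 <;> ring

theorem det_one_sub_smul_modeBlock (L : ℕ) [NeZero L] (W : ℂ) (m : ZMod L × ZMod L) :
    (1 - W • modeBlock L m).det =
      (1 + W ^ 2) ^ 2 - 2 * W * (1 - W ^ 2) *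
        ((Real.cos (2 * Real.pi * (m.1.val : ℝ) / (L : ℝ)) : ℂ) +
         (Real.cos (2 * Real.pi * (m.2.val : ℝ) / (L : ℝ)) : ℂ)) := by
  have hinv (a : ZMod L) : ZMod.stdAddChar a * ZMod.stdAddChar (-a) = (1 : ℂ) := by
    rw [← AddChar.map_add_eq_mul, add_neg_cancel, AddChar.map_zero_eq_one]
  have hstep : (fun i => torusFourier L (torusStep L i) m) =
      ![ZMod.stdAddChar m.1, ZMod.stdAddChar (-m.1),
        ZMod.stdAddChar m.2, ZMod.stdAddChar (-m.2)] := by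
    ext i
    fin_cases i <;> simp [torusFourier, torusStep, dirVec]
  have hblock : modeBlock L m = Matrix.of fun i j =>
      ![ZMod.stdAddChar m.1, ZMod.stdAddChar (-m.1),
        ZMod.stdAddChar m.2, ZMod.stdAddChar (-m.2)] i * phaseMatrix i j := by
    rw [← hstep]
    rfl
  rw [hblock, phaseMatrix_eq, det_four_direction_block _ _ _ _ _ _ _ (hinv _) (hinv _)]
  · linear_combination (-(W * (1 - W ^ 2))) *
      (stdAddChar_add_stdAddChar_neg L m.1 + stdAddChar_add_stdAddChar_neg L m.2)
  · rw [← Complex.exp_add]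
    simp [← add_div]
  · rw [← Complex.exp_nat_mul, ← Complex.exp_nat_mul]
    have hp : ((2 : ℕ) : ℂ) * (Complex.I * (Real.pi / 2 : ℝ) / 2) = Real.pi / 2 * Complex.I := by
      push_cast
      ring
    have hq : ((2 : ℕ) : ℂ) * (Complex.I * (-(Real.pi / 2) : ℝ) / 2) =
        -Real.pi / 2 * Complex.I := by
      push_cast
      ring
    rw [hp, hq, Complex.exp_pi_div_two_mul_I, Complex.exp_neg_pi_div_two_mul_I, add_neg_cancel]

/-- **Factorisation of the periodic Kac–Ward determinant over Fourier modes.**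
For `L ≥ 3` and every `W ∈ ℂ`,
`det(1 − W·K^per) = ∏_{m ∈ {0,…,L−1}²} [(1 + W²)² − 2W(1 − W²)(cos(2πm₁/L) + cos(2πm₂/L))]`. -/
theorem stmt_14 (L : ℕ) (hL : 3 ≤ L) [NeZero L] (W : ℂ) :
    Matrix.det (1 - W • KperM L) =
      ∏ m : Fin L × Fin L,
        ((1 + W ^ 2) ^ 2 - 2 * W * (1 - W ^ 2) *
          ((Real.cos (2 * Real.pi * (m.1 : ℝ) / (L : ℝ)) : ℂ) +
           (Real.cos (2 * Real.pi * (m.2 : ℝ) / (L : ℝ)) : ℂ))) := by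
  rw [det_one_sub_smul_KperM]
  simp_rw [det_one_sub_smul_modeBlock]
  obtain ⟨n, rfl⟩ : ∃ n, L = n + 1 := ⟨L - 1, by omega⟩
  rfl
end

section
/- Let W ∈ (0, 1) with W ≠ √2 − 1, and for L ≥ 3 let K^per_L be the periodic Kac–Ward matrix of the L × L torus. Then det(1 − W·K^per_L) is a positive real number and lim_{L→∞} (1/L²) log det(1 − W·K^per_L) = ∫_{[0,2π]²} log[ (1 + W²)² − 2W(1 − W²)(cos k₁ + cos k₂) ] dk₁ dk₂ / (2π)². -/
instance (n : ℕ) : NeZero (n + 3) := ⟨by omega⟩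

/-- The Kac–Ward phase of a left quarter turn. -/
noncomputable def quarterPhase : ℂ := Complex.exp (Complex.I * (Real.pi / 2 : ℝ) / 2)

theorem quarterPhase_ne_zero : quarterPhase ≠ 0 := Complex.exp_ne_zero _

theorem quarterPhase_sq : quarterPhase ^ 2 = Complex.I := by
  rw [quarterPhase, ← Complex.exp_nat_mul]
  convert Complex.exp_pi_div_two_mul_I using 2
  push_cast
  ring

theorem quarterPhase_inv : quarterPhase⁻¹ = Complex.exp (Complex.I * (-(Real.pi / 2) : ℝ) / 2) := by
  rw [quarterPhase, ← Complex.exp_neg]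
  congr 1
  push_cast
  ring

/-- The Kac–Ward weights between two consecutive directions. -/
noncomputable def turnMatrix : Matrix (Fin 4) (Fin 4) ℂ :=
  !![1, 0, quarterPhase, quarterPhase⁻¹;
    0, 1, quarterPhase⁻¹, quarterPhase;
    quarterPhase⁻¹, quarterPhase, 1, 0;
    quarterPhase, quarterPhase⁻¹, 0, 1]

theorem turnMatrix_apply (i j : Fin 4) :
    turnMatrix i j =
      if dirVec j ≠ -dirVec i then KWphase (dirVec i) (dirVec j) else 0 := by
  rw [turnMatrix, quarterPhase_inv, quarterPhase]
  fin_cases i <;> fin_cases j <;>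
    simp [dirVec, KWphase, dirC, Complex.arg_I, Complex.arg_neg_I]

/-- The Fourier symbol of `1 - W K^per` with translation phases `u`. -/
noncomputable def kwSymbol (W : ℂ) (u : Fin 4 → ℂ) : Matrix (Fin 4) (Fin 4) ℂ :=
  1 - W • Matrix.of fun d d' => u d * turnMatrix d d'

theorem det_kwSymbol (W z w : ℂ) (hz : z ≠ 0) (hw : w ≠ 0) :
    (kwSymbol W ![z, z⁻¹, w, w⁻¹]).det =
      (1 + W ^ 2) ^ 2 - W * (1 - W ^ 2) * (z + z⁻¹ + w + w⁻¹) := by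
  have hq : quarterPhase⁻¹ ^ 2 = - quarterPhase ^ 2 := by
    rw [inv_pow, quarterPhase_sq, Complex.inv_I]
  have hq' : quarterPhase * quarterPhase⁻¹ = 1 := mul_inv_cancel₀ quarterPhase_ne_zero
  have hz' : z * z⁻¹ = 1 := mul_inv_cancel₀ hz
  have hw' : w * w⁻¹ = 1 := mul_inv_cancel₀ hw
  simp only [kwSymbol, turnMatrix]
  generalize quarterPhase⁻¹ = b at *
  generalize quarterPhase = a at *
  generalize z⁻¹ = z' at *
  generalize w⁻¹ = w' at *
  simp [Matrix.det_succ_row_zero, Fin.sum_univ_succ, Matrix.submatrix_apply, Fin.succAbove,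
    Matrix.one_apply]
  grind

open ZMod in
/-- The character of the torus `(ℤ/Lℤ)²` with momentum `k`. -/
noncomputable def torusChar (L : ℕ) [NeZero L] (k x : ZMod L × ZMod L) : ℂ :=
  stdAddChar (k.1 * x.1) * stdAddChar (k.2 * x.2)

theorem torusChar_add (L : ℕ) [NeZero L] (k x y : ZMod L × ZMod L) :
    torusChar L k (x + y) = torusChar L k x * torusChar L k y := by
  simp only [torusChar, Prod.fst_add, Prod.snd_add, mul_add, AddChar.map_add_eq_mul]
  ring

theorem sum_torusChar_mul_neg (L : ℕ) [NeZero L] (x y : ZMod L × ZMod L) :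
    ∑ k, torusChar L k x * torusChar L k (-y) = if x = y then (L : ℂ) ^ 2 else 0 := by
  have h := ZMod.isPrimitive_stdAddChar L
  simp only [← torusChar_add]
  rw [Fintype.sum_prod_type]
  simp only [torusChar, ← Finset.mul_sum, ← Finset.sum_mul, AddChar.sum_mulShift _ h, ZMod.card]
  simp only [← sub_eq_add_neg, Prod.ext_iff, Prod.fst_sub, Prod.snd_sub, sub_eq_zero]
  split_ifs <;> simp_all [sq]

/-- The Fourier transform on the darts of the torus. -/
noncomputable def dartFourier (L : ℕ) [NeZero L] :
    Matrix ((ZMod L × ZMod L) × Fin 4) ((ZMod L × ZMod L) × Fin 4) ℂ :=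
  fun e e' => if e.2 = e'.2 then torusChar L e'.1 e.1 else 0

theorem det_dartFourier_ne_zero (L : ℕ) [NeZero L] : (dartFourier L).det ≠ 0 := by
  let G : Matrix ((ZMod L × ZMod L) × Fin 4) ((ZMod L × ZMod L) × Fin 4) ℂ :=
    fun e e' => if e.2 = e'.2 then torusChar L e.1 (-e'.1) else 0
  have hL : (L : ℂ) ≠ 0 := Nat.cast_ne_zero.mpr (NeZero.ne L)
  have h : dartFourier L * G = ((L : ℂ) ^ 2) • 1 := by
    ext ⟨x, d⟩ ⟨y, d'⟩
    rw [Matrix.mul_apply, Fintype.sum_prod_type]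
    simp only [dartFourier, G, mul_ite, ite_mul, zero_mul, mul_zero]
    simp only [← ite_and, Matrix.smul_apply, Matrix.one_apply, Prod.mk.injEq]
    by_cases hd : d = d'
    · subst hd
      have : ∀ k : ZMod L × ZMod L, ∀ i : Fin 4, (if i = d ∧ d = i then
          torusChar L k x * torusChar L k (-y) else 0) =
          if i = d then torusChar L k x * torusChar L k (-y) else 0 := by
        intro k i
        simp [eq_comm]
      simp only [this, Finset.sum_ite_eq', Finset.mem_univ, if_true, sum_torusChar_mul_neg]
      simp
    · have : ∀ i, ¬ (i = d' ∧ d = i) := by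
        rintro i ⟨rfl, rfl⟩
        exact hd rfl
      simp [this, hd]
  intro h0
  have := congrArg Matrix.det h
  rw [Matrix.det_mul, h0, zero_mul, Matrix.det_smul, Matrix.det_one, mul_one] at this
  exact pow_ne_zero _ (pow_ne_zero _ hL) this.symm

theorem KperM_apply (L : ℕ) (x x' : ZMod L × ZMod L) (d d' : Fin 4) :
    KperM L (x, d) (x', d') = if x' = x + torusStep L d then turnMatrix d d' else 0 := by
  rw [turnMatrix_apply, KperM, ite_and]

theorem KperM_mul_dartFourier (L : ℕ) [NeZero L] (x k : ZMod L × ZMod L) (d d' : Fin 4) :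
    (KperM L * dartFourier L) (x, d) (k, d') =
      torusChar L k x * (torusChar L k (torusStep L d) * turnMatrix d d') := by
  rw [Matrix.mul_apply, Fintype.sum_prod_type]
  simp only [KperM_apply, dartFourier, mul_ite, mul_zero, Finset.sum_ite_eq', Finset.mem_univ,
    if_true, ite_mul, zero_mul,
    torusChar_add]
  ring

theorem dartFourier_mul_submatrix (L : ℕ) [NeZero L]
    (M : ZMod L × ZMod L → Matrix (Fin 4) (Fin 4) ℂ) (x k : ZMod L × ZMod L) (d d' : Fin 4) :
    (dartFourier L * (Matrix.blockDiagonal M).submatrix Prod.swap Prod.swap) (x, d) (k, d') =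
      torusChar L k x * M k d d' := by
  rw [Matrix.mul_apply, Fintype.sum_prod_type]
  simp only [dartFourier, Matrix.submatrix_apply, Prod.swap_prod_mk, Matrix.blockDiagonal_apply]
  simp

theorem det_one_sub_KperM (L : ℕ) [NeZero L] (W : ℂ) :
    (1 - W • KperM L).det =
      ∏ k, (kwSymbol W fun d => torusChar L k (torusStep L d)).det := by
  have h : (1 - W • KperM L) * dartFourier L = dartFourier L *
      (Matrix.blockDiagonal fun k => kwSymbol W fun d => torusChar L k (torusStep L d)).submatrix
        Prod.swap Prod.swap := by
    ext ⟨x, d⟩ ⟨k, d'⟩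
    rw [dartFourier_mul_submatrix, sub_mul, one_mul, Matrix.smul_mul, Matrix.sub_apply,
      Matrix.smul_apply, KperM_mul_dartFourier, kwSymbol, Matrix.sub_apply, Matrix.smul_apply,
      Matrix.of_apply, dartFourier, Matrix.one_apply]
    simp only [smul_eq_mul]
    split_ifs <;> ring
  have h' := congrArg Matrix.det h
  rw [Matrix.det_mul, Matrix.det_mul, mul_comm] at h'
  rw [mul_left_cancel₀ (det_dartFourier_ne_zero L) h', ← Matrix.det_blockDiagonal]
  exact Matrix.det_submatrix_equiv_self (Equiv.prodComm _ _) _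

/-- The dispersion function: the determinant of the Fourier symbol at momentum `(x, y)`. -/
noncomputable def kwDispersion (W x y : ℝ) : ℝ :=
  (1 + W ^ 2) ^ 2 - 2 * W * (1 - W ^ 2) * (Real.cos x + Real.cos y)

theorem stdAddChar_add_inv (L : ℕ) [NeZero L] (j : ZMod L) :
    (ZMod.stdAddChar j : ℂ) + (ZMod.stdAddChar j)⁻¹ =
      2 * Real.cos (2 * Real.pi * (j.val / L)) := by
  rw [ZMod.stdAddChar_apply, ZMod.toCircle_eq_circleExp, Circle.coe_exp, ← Complex.exp_neg,
    Complex.ofReal_cos, Complex.two_cos, neg_mul]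

theorem det_one_sub_KperM_eq_prod (L : ℕ) [NeZero L] (W : ℝ) :
    (1 - (W : ℂ) • KperM L).det =
      ((∏ i ∈ Finset.range L, ∏ j ∈ Finset.range L,
        kwDispersion W (2 * Real.pi * (i / L)) (2 * Real.pi * (j / L)) : ℝ) : ℂ) := by
  have hprod : ∀ f : ℕ → ℝ, ∏ i ∈ Finset.range L, f i = ∏ i : ZMod L, f i.val := by
    intro f
    obtain ⟨m, rfl⟩ := Nat.exists_eq_succ_of_ne_zero (NeZero.ne L)
    exact Finset.prod_range f
  rw [det_one_sub_KperM]
  simp only [hprod]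
  rw [Fintype.prod_prod_type]
  push_cast
  refine Finset.prod_congr rfl fun i _ => Finset.prod_congr rfl fun j _ => ?_
  have hz (j : ZMod L) : (ZMod.stdAddChar j : ℂ) ≠ 0 := by
    rw [ZMod.stdAddChar_apply]
    exact Circle.coe_ne_zero _
  have hu : (fun d => torusChar L (i, j) (torusStep L d)) =
      ![(ZMod.stdAddChar i : ℂ), (ZMod.stdAddChar i)⁻¹, ZMod.stdAddChar j,
        (ZMod.stdAddChar j)⁻¹] := by
    funext d
    fin_cases d <;> simp [torusChar, torusStep, dirVec, AddChar.map_neg_eq_inv]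
  rw [hu, det_kwSymbol _ _ _ (hz i) (hz j), kwDispersion]
  have hi := stdAddChar_add_inv L i
  have hj := stdAddChar_add_inv L j
  push_cast at hi hj ⊢
  linear_combination (-(W : ℂ) * (1 - W ^ 2)) * (hi + hj)

theorem kwDispersion_lower_bound {W : ℝ} (hW0 : 0 < W) (hW1 : W < 1) (x y : ℝ) :
    (W ^ 2 + 2 * W - 1) ^ 2 ≤ kwDispersion W x y := by
  have h : 0 < W * (1 - W ^ 2) := mul_pos hW0 (by nlinarith)
  rw [kwDispersion]
  nlinarith [mul_le_mul_of_nonneg_left (add_le_add (Real.cos_le_one x) (Real.cos_le_one y)) h.le]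

theorem sq_add_two_mul_sub_one_ne_zero {W : ℝ} (hW0 : 0 < W) (hWc : W ≠ Real.sqrt 2 - 1) :
    W ^ 2 + 2 * W - 1 ≠ 0 := by
  intro h
  apply hWc
  rw [eq_sub_iff_add_eq, eq_comm, Real.sqrt_eq_iff_mul_self_eq (by norm_num) (by linarith)]
  linarith

theorem abs_log_sub_log_le {m a b : ℝ} (hm : 0 < m) (ha : m ≤ a) (hb : m ≤ b) :
    |Real.log a - Real.log b| ≤ m⁻¹ * |a - b| := by
  wlog h : b ≤ a generalizing a b
  · rw [abs_sub_comm, abs_sub_comm a]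
    exact this hb ha (le_of_not_ge h)
  have hb0 : 0 < b := hm.trans_le hb
  have ha0 : 0 < a := hm.trans_le ha
  rw [abs_of_nonneg (sub_nonneg.2 (Real.log_le_log hb0 h)), abs_of_nonneg (sub_nonneg.2 h),
    ← Real.log_div ha0.ne' hb0.ne']
  calc Real.log (a / b) ≤ a / b - 1 := Real.log_le_sub_one_of_pos (by positivity)
    _ = b⁻¹ * (a - b) := by field_simp
    _ ≤ m⁻¹ * (a - b) := by
      have := sub_nonneg.2 h
      gcongr

theorem average_riemann_sum_sub_integral_le {h : ℝ → ℝ} {C : ℝ}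
    (hh : ∀ x y, |h x - h y| ≤ C * |x - y|) (L : ℕ) [NeZero L] :
    |(∑ i ∈ Finset.range L, h (2 * Real.pi * (i / L))) / L -
      (1 / (2 * Real.pi)) * ∫ x in (0 : ℝ)..(2 * Real.pi), h x| ≤ C * (2 * Real.pi / L) := by
  have hC : 0 ≤ C := by simpa using (abs_nonneg _).trans (hh 1 0)
  have hcont : Continuous h :=
    (LipschitzWith.of_dist_le_mul (K := ⟨C, hC⟩) fun x y => by
      simpa [Real.dist_eq] using! hh x y).continuous
  have hL : (0 : ℝ) < L := Nat.cast_pos.mpr (NeZero.pos L)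
  have hpi := Real.pi_pos
  set δ : ℝ := 2 * Real.pi / L with hδ
  have hδ0 : 0 < δ := by positivity
  have hstep (i : ℕ) : 2 * Real.pi * ((i + 1 : ℕ) / L) = 2 * Real.pi * (i / L) + δ := by
    rw [hδ]
    push_cast
    ring
  have hint : ∫ x in (0 : ℝ)..(2 * Real.pi), h x = ∑ i ∈ Finset.range L,
      ∫ x in (2 * Real.pi * (i / L))..(2 * Real.pi * ((i + 1 : ℕ) / L)), h x := by
    rw [intervalIntegral.sum_integral_adjacent_intervals
      (a := fun i : ℕ => 2 * Real.pi * (i / L)) fun k _ => hcont.intervalIntegrable _ _]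
    simp [hL.ne']
  have hcell (i : ℕ) : |δ * h (2 * Real.pi * (i / L)) -
      ∫ x in (2 * Real.pi * (i / L))..(2 * Real.pi * ((i + 1 : ℕ) / L)), h x| ≤ C * δ * δ := by
    rw [hstep]
    set a := 2 * Real.pi * ((i : ℝ) / L)
    have : δ * h a - ∫ x in a..(a + δ), h x = ∫ x in a..(a + δ), (h a - h x) := by
      rw [intervalIntegral.integral_sub (by simp) (hcont.intervalIntegrable _ _)]
      simp
    rw [this]
    refine (intervalIntegral.norm_integral_le_of_norm_le_const (f := fun x => h a - h x)
      (C := C * δ) fun x hx => ?_).trans ?_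
    · rw [Set.uIoc_of_le (by linarith)] at hx
      refine (hh a x).trans (mul_le_mul_of_nonneg_left ?_ hC)
      rw [abs_le]
      constructor <;> linarith [hx.1, hx.2]
    · rw [add_sub_cancel_left, abs_of_pos hδ0]
  have hsum : |∑ i ∈ Finset.range L, (δ * h (2 * Real.pi * (i / L)) -
      ∫ x in (2 * Real.pi * (i / L))..(2 * Real.pi * ((i + 1 : ℕ) / L)), h x)| ≤
      L * (C * δ * δ) := by
    refine (Finset.abs_sum_le_sum_abs _ _).trans ?_
    simpa using Finset.sum_le_sum fun i (_ : i ∈ Finset.range L) => hcell i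
  rw [Finset.sum_sub_distrib, ← hint, ← Finset.mul_sum] at hsum
  have hLδ : L * δ = 2 * Real.pi := by
    rw [hδ]
    field_simp
  calc _ = |(1 / (2 * Real.pi)) * (δ * ∑ i ∈ Finset.range L, h (2 * Real.pi * (i / L)) -
        ∫ x in (0 : ℝ)..(2 * Real.pi), h x)| := by
        rw [hδ]
        congr 1
        field_simp
    _ ≤ (1 / (2 * Real.pi)) * (L * (C * δ * δ)) := by
        rw [abs_mul, abs_of_pos (by positivity : 0 < 1 / (2 * Real.pi))]
        gcongr
    _ = C * δ := by
        rw [← hLδ]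
        field_simp

/-- A double Riemann sum of a function that is Lipschitz in each variable approximates its
mean over `[0, 2π]²` with error `O(1/L)`. -/
theorem average_riemann_sum_sub_double_integral_le {g : ℝ → ℝ → ℝ} {C : ℝ}
    (hx : ∀ x x' y, |g x y - g x' y| ≤ C * |x - x'|)
    (hy : ∀ x y y', |g x y - g x y'| ≤ C * |y - y'|) (L : ℕ) [NeZero L] :
    |(∑ i ∈ Finset.range L, ∑ j ∈ Finset.range L,
        g (2 * Real.pi * (i / L)) (2 * Real.pi * (j / L))) / L ^ 2 -
      (1 / (2 * Real.pi) ^ 2) * ∫ x in (0 : ℝ)..(2 * Real.pi), ∫ y in (0 : ℝ)..(2 * Real.pi),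
        g x y| ≤ 2 * C * (2 * Real.pi / L) := by
  have hC : 0 ≤ C := by simpa using (abs_nonneg _).trans (hx 1 0 0)
  have hL : (0 : ℝ) < L := Nat.cast_pos.mpr (NeZero.pos L)
  have hpi := Real.pi_pos
  have hcont (x : ℝ) : Continuous (g x) :=
    (LipschitzWith.of_dist_le_mul (K := ⟨C, hC⟩) fun y y' => by
      simpa [Real.dist_eq] using! hy x y y').continuous
  let A : ℝ → ℝ := fun x => (1 / (2 * Real.pi)) * ∫ y in (0 : ℝ)..(2 * Real.pi), g x y
  have hA (x x' : ℝ) : |A x - A x'| ≤ C * |x - x'| := by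
    have h := intervalIntegral.norm_integral_le_of_norm_le_const (a := 0) (b := 2 * Real.pi)
      (C := C * |x - x'|) (f := fun y => g x y - g x' y) fun y _ => hx x x' y
    rw [intervalIntegral.integral_sub ((hcont x).intervalIntegrable _ _)
      ((hcont x').intervalIntegrable _ _), sub_zero,
      abs_of_pos (by positivity : 0 < 2 * Real.pi), Real.norm_eq_abs] at h
    rw [← mul_sub, abs_mul, abs_of_pos (by positivity : 0 < 1 / (2 * Real.pi)), one_div,
      inv_mul_le_iff₀ (by positivity)]
    linarith
  have hfirst := average_riemann_sum_sub_integral_le hA L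
  have hsecond : |(∑ i ∈ Finset.range L, ((∑ j ∈ Finset.range L,
      g (2 * Real.pi * (i / L)) (2 * Real.pi * (j / L))) / L - A (2 * Real.pi * (i / L)))) / L| ≤
      C * (2 * Real.pi / L) := by
    rw [abs_div, abs_of_pos hL, div_le_iff₀ hL]
    refine (Finset.abs_sum_le_sum_abs _ _).trans ?_
    refine (Finset.sum_le_sum fun (i : ℕ) _ =>
      average_riemann_sum_sub_integral_le (hy (2 * Real.pi * (i / L))) L).trans ?_
    simp [mul_comm]
  have hadd := (abs_add_le _ _).trans (add_le_add hsecond hfirst)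
  rw [Finset.sum_sub_distrib, sub_div, sub_add_sub_cancel, intervalIntegral.integral_const_mul,
    ← Finset.sum_div, div_div, ← sq, ← mul_assoc, one_div_mul_one_div, ← sq] at hadd
  linarith

theorem abs_log_kwDispersion_sub_le {W : ℝ} (hW0 : 0 < W) (hW1 : W < 1)
    (hWc : W ≠ Real.sqrt 2 - 1) (x y x' y' : ℝ) :
    |Real.log (kwDispersion W x y) - Real.log (kwDispersion W x' y')| ≤
      ((W ^ 2 + 2 * W - 1) ^ 2)⁻¹ * (2 * W * (1 - W ^ 2)) * (|x - x'| + |y - y'|) := by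
  have hm : 0 < (W ^ 2 + 2 * W - 1) ^ 2 :=
    sq_pos_of_ne_zero (sq_add_two_mul_sub_one_ne_zero hW0 hWc)
  have hc : 0 < 2 * W * (1 - W ^ 2) := mul_pos (by linarith) (by nlinarith)
  refine (abs_log_sub_log_le hm (kwDispersion_lower_bound hW0 hW1 x y)
    (kwDispersion_lower_bound hW0 hW1 x' y')).trans ?_
  rw [mul_assoc]
  refine mul_le_mul_of_nonneg_left ?_ (inv_nonneg.2 hm.le)
  have : kwDispersion W x y - kwDispersion W x' y' = -(2 * W * (1 - W ^ 2)) *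
      ((Real.cos x - Real.cos x') + (Real.cos y - Real.cos y')) := by
    rw [kwDispersion, kwDispersion]
    ring
  rw [this, abs_mul, abs_neg, abs_of_pos hc]
  gcongr
  exact (abs_add_le _ _).trans
    (add_le_add (Real.abs_cos_sub_cos_le x x') (Real.abs_cos_sub_cos_le y y'))

/-- **Thermodynamic limit of the periodic Kac–Ward determinant.**
For `W ∈ (0,1)` with `W ≠ √2 − 1`, the determinant `det(1 − W·K^per_L)` is a positive
real number for every `L ≥ 3`, and
`lim_{L→∞} (1/L²) log det(1 − W·K^per_L)`
`= ∫_{[0,2π]²} log[(1 + W²)² − 2W(1 − W²)(cos k₁ + cos k₂)] dk₁dk₂/(2π)²`. -/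
theorem stmt_16 (W : ℝ) (hW0 : 0 < W) (hW1 : W < 1) (hWc : W ≠ Real.sqrt 2 - 1) :
    (∀ (L : ℕ), 3 ≤ L → ∀ [NeZero L],
      (Matrix.det (1 - (W : ℂ) • KperM L)).im = 0 ∧
      0 < (Matrix.det (1 - (W : ℂ) • KperM L)).re) ∧
    Filter.Tendsto
      (fun n : ℕ =>
        Real.log ((Matrix.det (1 - (W : ℂ) • KperM (n + 3))).re) / ((n : ℝ) + 3) ^ 2)
      Filter.atTop
      (nhds ((1 / (2 * Real.pi) ^ 2) *
        ∫ k₁ in (0 : ℝ)..(2 * Real.pi), ∫ k₂ in (0 : ℝ)..(2 * Real.pi),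
          Real.log ((1 + W ^ 2) ^ 2 - 2 * W * (1 - W ^ 2) *
            (Real.cos k₁ + Real.cos k₂)))) := by
  have hpos (L : ℕ) (i j : ℕ) :
      0 < kwDispersion W (2 * Real.pi * (i / L)) (2 * Real.pi * (j / L)) :=
    (sq_pos_of_ne_zero (sq_add_two_mul_sub_one_ne_zero hW0 hWc)).trans_le
      (kwDispersion_lower_bound hW0 hW1 _ _)
  constructor
  · intro L _ _
    rw [det_one_sub_KperM_eq_prod]
    refine ⟨Complex.ofReal_im _, ?_⟩
    rw [Complex.ofReal_re]
    exact Finset.prod_pos fun i _ => Finset.prod_pos fun j _ => hpos L i j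
  set C := ((W ^ 2 + 2 * W - 1) ^ 2)⁻¹ * (2 * W * (1 - W ^ 2))
  have hbound (n : ℕ) := average_riemann_sum_sub_double_integral_le
    (g := fun x y => Real.log (kwDispersion W x y)) (C := C)
    (fun x x' y => by simpa using abs_log_kwDispersion_sub_le hW0 hW1 hWc x y x' y)
    (fun x y y' => by simpa using abs_log_kwDispersion_sub_le hW0 hW1 hWc x y x y') (n + 3)
  have hlim : Filter.Tendsto (fun n : ℕ => 2 * C * (2 * Real.pi / ((n + 3 : ℕ) : ℝ)))
      Filter.atTop (nhds 0) := by
    simpa using ((tendsto_const_div_atTop_nhds_zero_nat (2 * Real.pi)).comp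
      (Filter.tendsto_add_atTop_nat 3)).const_mul (2 * C)
  rw [tendsto_iff_dist_tendsto_zero]
  refine squeeze_zero (fun _ => dist_nonneg) (fun n => ?_) hlim
  rw [Real.dist_eq, det_one_sub_KperM_eq_prod, Complex.ofReal_re,
    Real.log_prod fun i _ => (Finset.prod_pos fun j _ => hpos (n + 3) i j).ne']
  simp only [Real.log_prod fun j _ => (hpos (n + 3) _ j).ne']
  exact_mod_cast hbound n
end
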